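/- arXiv:2101.03856 — 3 statements merged into one kernel-verified Lean document; each statement's English description precedes it below -/
import Mathlib

section
/- Let f : [0,1] → ℝ be a càdlàg function and let (λ_n)_{n≥1} be a sequence of increasing homeomorphisms from [0,1] onto itself such that sup_{t∈[0,1]} |λ_n(t) − t| → 0 as n → ∞. Then ∫₀¹ |f(λ_n(s)) − f(s)| ds → 0 as n → ∞. -/
open Set Filter Topology MeasureTheory
open scoped ENNReal NNReal

noncomputable section

/-- `f : ℝ → ℝ` is càdlàg on `[0,1]`: right-continuous on `[0,1)` and
with left limits at every point of `(0,1]`. -/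
def IsCadlag (f : ℝ → ℝ) : Prop :=
  (∀ t ∈ Set.Ico (0:ℝ) 1, Filter.Tendsto f (nhdsWithin t (Set.Ici t)) (nhds (f t))) ∧
  (∀ t ∈ Set.Ioc (0:ℝ) 1, ∃ L : ℝ, Filter.Tendsto f (nhdsWithin t (Set.Iio t)) (nhds L))

/-- The projection of `ℝ` onto `[0,1]`. -/
def projI (t : ℝ) : ℝ := max 0 (min 1 t)

/-- Canonical representation of elements of the Skorokhod space `D([0,1])`:
càdlàg on `[0,1]` and determined by the values on `[0,1]`. -/
def MemD (f : ℝ → ℝ) : Prop := IsCadlag f ∧ ∀ t : ℝ, f t = f (projI t)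

/-- An increasing homeomorphism of `[0,1]` onto itself. -/
def IsTimeChange (l : ℝ → ℝ) : Prop :=
  StrictMonoOn l (Set.Icc 0 1) ∧ ContinuousOn l (Set.Icc 0 1) ∧
    Set.MapsTo l (Set.Icc 0 1) (Set.Icc 0 1) ∧ l 0 = 0 ∧ l 1 = 1

/-- The Skorokhod `J1` distance on paths over `[0,1]`. -/
def J1dist (x y : ℝ → ℝ) : ℝ :=
  sInf { r : ℝ | ∃ l : ℝ → ℝ, IsTimeChange l ∧
    r = max (⨆ t : Set.Icc (0:ℝ) 1, |l t - (t : ℝ)|)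
            (⨆ t : Set.Icc (0:ℝ) 1, |x (l t) - y t|) }

/-- The Skorokhod space `D = D([0,1])`. -/
def DD : Type := { f : ℝ → ℝ // MemD f }

/-- The `J1` topology on `D`, generated by the `J1` balls. -/
instance : TopologicalSpace DD :=
  TopologicalSpace.generateFrom
    { S : Set DD | ∃ (x : DD) (ε : ℝ), 0 < ε ∧ S = { y : DD | J1dist x.1 y.1 < ε } }

/-- The Borel σ-algebra on `D`. -/
instance : MeasurableSpace DD := borel DD

/-- The zero path. -/
def zeroPath : DD :=
  ⟨fun _ => 0, ⟨fun _ _ => tendsto_const_nhds, fun _ _ => ⟨0, tendsto_const_nhds⟩⟩, fun _ => rfl⟩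

/-- `f` solves the ODE `f t = ∫_0^t b (f s) ds + g t` on `[0,1]`. -/
def SolvesODE (b : ℝ → ℝ) (g f : ℝ → ℝ) : Prop :=
  ∀ t ∈ Set.Icc (0:ℝ) 1, f t = (∫ s in (0:ℝ)..t, b (f s)) + g t

/-- `A` is bounded away from `B`. -/
def BoundedAway (A B : Set DD) : Prop :=
  ∃ ε : ℝ, 0 < ε ∧ ∀ x ∈ A, ∀ y ∈ B, ε ≤ J1dist x.1 y.1

/-- `A` is a bounded subset of `D`. -/
def BoundedSet (A : Set DD) : Prop :=
  ∃ M : ℝ, ∀ x ∈ A, J1dist x.1 zeroPath.1 ≤ M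

/-- `D_{l,m}`: step functions vanishing at the origin with exactly `l` upward jumps
and `m` downward jumps. -/
def Dlm (l m : ℕ) : Set DD :=
  { f : DD | ∃ (u : Fin l → ℝ) (x : Fin l → ℝ) (v : Fin m → ℝ) (y : Fin m → ℝ),
      Function.Injective u ∧ Function.Injective v ∧ (∀ i j, u i ≠ v j) ∧
      (∀ i, u i ∈ Set.Ioc (0:ℝ) 1) ∧ (∀ i, 0 < x i) ∧
      (∀ j, v j ∈ Set.Ioc (0:ℝ) 1) ∧ (∀ j, 0 < y j) ∧
      ∀ t : ℝ, f.1 t = (∑ i, if u i ≤ projI t then x i else 0)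
                     - (∑ j, if v j ≤ projI t then y j else 0) }

/-- `𝓘(j,k) = (α-1) j + (β-1) k`. -/
def Ical (α β : ℝ) (p : ℕ × ℕ) : ℝ := (α - 1) * p.1 + (β - 1) * p.2

/-- `D_{<j,k}`. -/
def Dlt (α β : ℝ) (j k : ℕ) : Set DD :=
  ⋃ (p : ℕ × ℕ) (_ : p ≠ (j, k) ∧ Ical α β p ≤ Ical α β (j, k)), Dlm p.1 p.2

/-- The rate function `I`. -/
def Ifun (α β : ℝ) (ξ : DD) : ℝ≥0∞ :=
  ⨅ (p : ℕ × ℕ) (_ : ξ ∈ Dlm p.1 p.2), ENNReal.ofReal (Ical α β p)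

/-- The rate function `Ĩ` (relative to the solution map `F`). -/
def Itilde (α β : ℝ) (F : DD → DD) (ξ : DD) : ℝ≥0∞ :=
  ⨅ (p : ℕ × ℕ) (_ : ∃ η : DD, η ∈ Dlm p.1 p.2 ∧ F η = ξ), ENNReal.ofReal (Ical α β p)

/-- The largest upward and downward jump sizes of a path. -/
def piMap (f : ℝ → ℝ) : ℝ × ℝ :=
  (⨆ t : Set.Ioc (0:ℝ) 1, (f t - Function.leftLim f t),
   ⨆ t : Set.Ioc (0:ℝ) 1, (Function.leftLim f t - f t))

/-- Extended logarithm `ℝ≥0∞ → EReal`, with `elog 0 = ⊥` and `elog ⊤ = ⊤`. -/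
def elog (x : ℝ≥0∞) : EReal :=
  if x = 0 then ⊥ else if x = ⊤ then ⊤ else ((Real.log x.toReal : ℝ) : EReal)

end

/-- A function with left limits on `(0,1]` has at most countably many discontinuities in `(0,1)`. -/
theorem countable_not_continuousAt_of_leftLimits {f : ℝ → ℝ}
    (hf : ∀ t ∈ Ioc (0:ℝ) 1, ∃ L : ℝ, Tendsto f (𝓝[<] t) (𝓝 L)) :
    {t ∈ Ioo (0:ℝ) 1 | ¬ ContinuousAt f t}.Countable := by
  let D : ℕ → Set ℝ := fun k =>
    {t ∈ Ioo (0:ℝ) 1 | ¬ ∀ᶠ s in 𝓝 t, dist (f s) (f t) < 1 / ((k:ℝ) + 1)}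
  have hD : ∀ k, (D k).Countable := by
    intro k
    have hisol : {t ∈ D k | 𝓝[D k ∩ Iio t] t = ⊥}.Countable :=
      countable_setOfPred_isolated_left_within
    refine hisol.mono fun t ht => mem_sep ht ?_
    obtain ⟨L, hL⟩ := hf t ⟨ht.1.1, ht.1.2.le⟩
    have hε : (0:ℝ) < 1 / ((k:ℝ) + 1) / 2 := by positivity
    obtain ⟨a, hat, ha⟩ := (mem_nhdsLT_iff_exists_Ioo_subset (a := t)).1
      (hL (Metric.ball_mem_nhds L hε))
    have hdisj : ∀ s ∈ Ioo a t, s ∉ D k := fun s hs hsD => hsD.2 <| by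
      filter_upwards [Ioo_mem_nhds hs.1 hs.2] with u hu
      have h₁ : dist (f u) L < _ := ha hu
      have h₂ : dist (f s) L < _ := ha hs
      linarith [dist_triangle_right (f u) (f s) L]
    rw [← Filter.empty_mem_iff_bot]
    filter_upwards [self_mem_nhdsWithin, mem_nhdsWithin_of_mem_nhds (Ioi_mem_nhds hat)] with s hs has
    exact hdisj s ⟨has, hs.2⟩ hs.1
  refine (Set.countable_iUnion hD).mono fun t ht => ?_
  by_contra hcon
  refine ht.2 (Metric.tendsto_nhds.2 fun ε hε => ?_)
  obtain ⟨k, hk⟩ := exists_nat_one_div_lt hε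
  by_contra hev
  refine hcon (mem_iUnion.2 ⟨k, ht.1, fun h => hev (h.mono fun s hs => hs.trans hk)⟩)

/-- A càdlàg function is bounded on `[0,1]`. -/
theorem IsCadlag.exists_abs_le {f : ℝ → ℝ} (hf : IsCadlag f) :
    ∃ C : ℝ, ∀ t ∈ Icc (0:ℝ) 1, |f t| ≤ C := by
  have bdd_of_tendsto : ∀ {F : Filter ℝ} {L : ℝ}, Tendsto f F (𝓝 L) →
      ∃ C : ℝ, ∀ᶠ s in F, |f s| ≤ C := fun {F L} h =>
    ⟨|L| + 1, (h.abs.eventually (gt_mem_nhds (lt_add_one |L|))).mono fun _ hs => hs.le⟩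
  refine isCompact_Icc.induction_on (p := fun s => ∃ C : ℝ, ∀ t ∈ s, |f t| ≤ C)
    ⟨0, by simp⟩ (fun s t hst ⟨C, hC⟩ => ⟨C, fun u hu => hC u (hst hu)⟩) ?_ ?_
  · rintro s t ⟨C, hC⟩ ⟨C', hC'⟩
    refine ⟨max C C', ?_⟩
    rintro u (hu | hu)
    · exact (hC u hu).trans (le_max_left _ _)
    · exact (hC' u hu).trans (le_max_right _ _)
  · intro x hx
    have hright : ∃ C : ℝ, ∀ᶠ s in 𝓝[Icc 0 1 ∩ Ici x] x, |f s| ≤ C := by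
      rcases hx.2.lt_or_eq with h | rfl
      · obtain ⟨C, hC⟩ := bdd_of_tendsto (hf.1 x ⟨hx.1, h⟩)
        exact ⟨C, hC.filter_mono (nhdsWithin_mono _ inter_subset_right)⟩
      · refine ⟨|f 1|, ?_⟩
        filter_upwards [self_mem_nhdsWithin] with s hs
        rw [le_antisymm hs.1.2 hs.2]
    have hleft : ∃ C : ℝ, ∀ᶠ s in 𝓝[Icc 0 1 ∩ Iio x] x, |f s| ≤ C := by
      rcases hx.1.lt_or_eq with h | rfl
      · obtain ⟨L, hL⟩ := hf.2 x ⟨h, hx.2⟩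
        obtain ⟨C, hC⟩ := bdd_of_tendsto hL
        exact ⟨C, hC.filter_mono (nhdsWithin_mono _ inter_subset_right)⟩
      · refine ⟨0, ?_⟩
        filter_upwards [self_mem_nhdsWithin] with s hs
        exact absurd hs.2 (not_lt.2 hs.1.1)
    obtain ⟨C, hC⟩ := hright
    obtain ⟨C', hC'⟩ := hleft
    refine ⟨{s | |f s| ≤ max C C'}, ?_, max C C', fun _ h => h⟩
    have hsplit : Icc (0:ℝ) 1 = (Icc 0 1 ∩ Ici x) ∪ (Icc 0 1 ∩ Iio x) := by
      rw [← inter_union_distrib_left, union_comm, Iio_union_Ici, inter_univ]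
    rw [hsplit, nhdsWithin_union]
    exact ⟨hC.mono fun s hs => hs.trans (le_max_left _ _),
      hC'.mono fun s hs => hs.trans (le_max_right _ _)⟩

/-- A function continuous at each point of an open set outside a countable set is almost everywhere
strongly measurable there. -/
theorem aestronglyMeasurable_restrict_of_continuousAt_off_countable {f : ℝ → ℝ} {U S : Set ℝ}
    (hU : MeasurableSet U) (hS : S.Countable) (hf : ∀ t ∈ U \ S, ContinuousAt f t) :
    AEStronglyMeasurable f (volume.restrict U) := by
  have h : AEStronglyMeasurable f (volume.restrict (U \ S)) :=
    ContinuousOn.aestronglyMeasurable (fun t ht => (hf t ht).continuousWithinAt)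
      (hU.diff hS.measurableSet)
  rwa [Measure.restrict_congr_set (sdiff_null_ae_eq_self (hS.measure_zero volume))] at h

theorem IsTimeChange.mapsTo_Ioo {l : ℝ → ℝ} (hl : IsTimeChange l) :
    MapsTo l (Ioo 0 1) (Ioo 0 1) := by
  obtain ⟨hmono, -, -, h0, h1⟩ := hl
  intro t ht
  have htI := Ioo_subset_Icc_self ht
  exact ⟨h0 ▸ hmono (left_mem_Icc.2 zero_le_one) htI ht.1,
    h1 ▸ hmono htI (right_mem_Icc.2 zero_le_one) ht.2⟩

theorem IsTimeChange.continuousAt {l : ℝ → ℝ} (hl : IsTimeChange l) {t : ℝ}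
    (ht : t ∈ Ioo (0:ℝ) 1) : ContinuousAt l t :=
  hl.2.1.continuousAt (Icc_mem_nhds ht.1 ht.2)

theorem IsTimeChange.abs_sub_le_iSup {l : ℝ → ℝ} (hl : IsTimeChange l) {s : ℝ}
    (hs : s ∈ Icc (0:ℝ) 1) : |l s - s| ≤ ⨆ t : Icc (0:ℝ) 1, |l t - (t : ℝ)| := by
  refine le_ciSup (f := fun t : Icc (0:ℝ) 1 => |l t - (t : ℝ)|) ⟨1, ?_⟩ ⟨s, hs⟩
  rintro _ ⟨t, rfl⟩
  have ht := hl.2.2.1 t.2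
  exact abs_le.2 ⟨by linarith [ht.1, t.2.2], by linarith [ht.2, t.2.1]⟩

/-- For càdlàg `f` and time changes `λₙ` with `sup_{t∈[0,1]} |λₙ t - t| → 0`,
one has `∫₀¹ |f (λₙ s) - f s| ds → 0`. -/
theorem cadlag_timeChange_integral_tendsto_zero
    (f : ℝ → ℝ) (hf : IsCadlag f) (l : ℕ → ℝ → ℝ) (hl : ∀ n, IsTimeChange (l n))
    (hconv : Filter.Tendsto (fun n => ⨆ t : Set.Icc (0:ℝ) 1, |l n t - (t : ℝ)|)
      Filter.atTop (nhds 0)) :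
    Filter.Tendsto (fun n => ∫ s in (0:ℝ)..1, |f (l n s) - f s|)
      Filter.atTop (nhds 0) := by
  obtain ⟨C, hC⟩ := hf.exists_abs_le
  let D := {t ∈ Ioo (0:ℝ) 1 | ¬ ContinuousAt f t}
  have hD : D.Countable := countable_not_continuousAt_of_leftLimits hf.2
  have hcont : ∀ t ∈ Ioo (0:ℝ) 1 \ D, ContinuousAt f t := fun t ht => by
    by_contra h
    exact ht.2 ⟨ht.1, h⟩
  have hmeas : AEStronglyMeasurable f (volume.restrict (Ioo 0 1)) :=
    aestronglyMeasurable_restrict_of_continuousAt_off_countable measurableSet_Ioo hD hcont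
  have hmeas_comp : ∀ n, AEStronglyMeasurable (fun s => f (l n s)) (volume.restrict (Ioo 0 1)) := by
    intro n
    have hinj : InjOn (l n) (Ioo 0 1 ∩ l n ⁻¹' D) :=
      (hl n).1.injOn.mono (inter_subset_left.trans Ioo_subset_Icc_self)
    have hpre : (Ioo 0 1 ∩ l n ⁻¹' D).Countable :=
      MapsTo.countable_of_injOn (f := l n) (fun _ ht => ht.2) hinj hD
    refine aestronglyMeasurable_restrict_of_continuousAt_off_countable measurableSet_Ioo hpre ?_
    intro t ht
    exact (hcont (l n t) ⟨(hl n).mapsTo_Ioo ht.1, fun h => ht.2 ⟨ht.1, h⟩⟩).comp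
      ((hl n).continuousAt ht.1)
  have hlim : ∀ s ∈ Icc (0:ℝ) 1, Tendsto (fun n => l n s) atTop (𝓝 s) := fun s hs =>
    tendsto_iff_dist_tendsto_zero.2 <|
      squeeze_zero (fun _ => dist_nonneg) (fun n => (hl n).abs_sub_le_iSup hs) hconv
  have hDCT : Tendsto (fun n => ∫ s in Ioo (0:ℝ) 1, |f (l n s) - f s|) atTop
      (𝓝 (∫ _ in Ioo (0:ℝ) 1, (0:ℝ))) := by
    refine tendsto_integral_of_dominated_convergence (fun _ => C + C)
      (fun n => ((hmeas_comp n).sub hmeas).norm) (integrable_const _) (fun n => ?_) ?_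
    · filter_upwards [ae_restrict_mem measurableSet_Ioo] with s hs
      have hsI := Ioo_subset_Icc_self hs
      rw [Real.norm_eq_abs, abs_abs]
      exact (abs_sub _ _).trans (add_le_add (hC _ ((hl n).2.2.1 hsI)) (hC s hsI))
    · filter_upwards [ae_restrict_mem measurableSet_Ioo,
        ae_restrict_of_ae (hD.ae_notMem volume)] with s hs hsD
      have h := ((hcont s ⟨hs, hsD⟩).tendsto.comp (hlim s (Ioo_subset_Icc_self hs))).sub_const (f s)
      simpa using h.abs
  simpa [intervalIntegral.integral_of_le zero_le_one, integral_Ioc_eq_integral_Ioo] using hDCT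
end

section
/- Let b : ℝ → ℝ be a bounded Lipschitz continuous function. Then for every càdlàg function g : [0,1] → ℝ there exists a unique càdlàg function f : [0,1] → ℝ satisfying f(t) = ∫₀ᵗ b(f(s)) ds + g(t) for all t ∈ [0,1]. -/
open Set Filter Topology MeasureTheory
open scoped ENNReal NNReal

/-- A right-continuous real function is Borel measurable. -/
theorem measurable_of_continuousWithinAt_Ici {g : ℝ → ℝ}
    (hg : ∀ t, ContinuousWithinAt g (Ici t) t) : Measurable g := by
  refine measurable_of_tendsto_metrizable
    (f := fun (n : ℕ) t => g (((⌊((n : ℝ) + 1) * t⌋ : ℤ) + 1 : ℝ) / ((n : ℝ) + 1))) ?_ ?_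
  · intro n
    exact (measurable_of_countable fun k : ℤ => g (((k : ℝ) + 1) / ((n : ℝ) + 1))).comp
      (Int.measurable_floor.comp (measurable_const.mul measurable_id))
  · rw [tendsto_pi_nhds]
    intro t
    have hpos : ∀ n : ℕ, (0 : ℝ) < (n : ℝ) + 1 := fun n => by positivity
    have hlower : ∀ n : ℕ,
        t ≤ ((⌊((n : ℝ) + 1) * t⌋ : ℤ) + 1 : ℝ) / ((n : ℝ) + 1) := fun n => by
      rw [le_div_iff₀ (hpos n), mul_comm]
      exact (Int.lt_floor_add_one _).le
    have hupper : ∀ n : ℕ,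
        ((⌊((n : ℝ) + 1) * t⌋ : ℤ) + 1 : ℝ) / ((n : ℝ) + 1) ≤ t + 1 / ((n : ℝ) + 1) := fun n => by
      rw [div_le_iff₀ (hpos n), add_mul t, div_mul_cancel₀ _ (hpos n).ne', mul_comm t]
      exact add_le_add_left (Int.floor_le _) 1
    refine (hg t).tendsto.comp (tendsto_nhdsWithin_iff.2 ⟨?_, .of_forall hlower⟩)
    refine tendsto_of_tendsto_of_tendsto_of_le_of_le tendsto_const_nhds ?_ hlower hupper
    simpa using tendsto_const_nhds.add (tendsto_one_div_add_atTop_nhds_zero_nat (𝕜 := ℝ))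

theorem projI_mem (t : ℝ) : projI t ∈ Icc (0 : ℝ) 1 :=
  ⟨le_max_left _ _, max_le zero_le_one (min_le_left _ _)⟩

theorem projI_of_mem {t : ℝ} (ht : t ∈ Icc (0 : ℝ) 1) : projI t = t := by
  rw [projI, min_eq_right ht.2, max_eq_right ht.1]

theorem continuous_projI : Continuous projI := by
  unfold projI
  fun_prop

theorem MemD.measurable {g : ℝ → ℝ} (hg : MemD g) : Measurable g := by
  refine measurable_of_continuousWithinAt_Ici fun t => ?_
  rcases lt_or_ge t 0 with h0 | h0
  · refine ContinuousAt.continuousWithinAt ?_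
    refine (continuousAt_const (y := g 0)).congr ?_
    filter_upwards [Iio_mem_nhds h0] with s hs
    rw [hg.2 s, projI, max_eq_left ((min_le_right _ _).trans (le_of_lt hs))]
  · rcases lt_or_ge t 1 with h1 | h1
    · exact hg.1.1 t ⟨h0, h1⟩
    · have h : ∀ s ∈ Ici t, g s = g 1 := fun s hs => by
        rw [hg.2 s, projI, min_eq_left (h1.trans hs), max_eq_right zero_le_one]
      exact (continuousWithinAt_const (b := g 1)).congr h (h t self_mem_Ici)

theorem MemD.add_continuous {g u : ℝ → ℝ} (hg : MemD g) (hu : Continuous u) :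
    MemD fun t => u (projI t) + g t := by
  have hc : Continuous fun t => u (projI t) := hu.comp continuous_projI
  refine ⟨⟨fun t ht => ?_, fun t ht => ?_⟩, fun t => ?_⟩
  · exact (hc.tendsto t |>.mono_left nhdsWithin_le_nhds).add (hg.1.1 t ht)
  · obtain ⟨L, hL⟩ := hg.1.2 t ht
    exact ⟨_, (hc.tendsto t |>.mono_left nhdsWithin_le_nhds).add hL⟩
  · simp only [projI_of_mem (projI_mem t), ← hg.2 t]

theorem MemD.eq_of_eqOn {f₁ f₂ : ℝ → ℝ} (h₁ : MemD f₁) (h₂ : MemD f₂)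
    (h : EqOn f₁ f₂ (Icc 0 1)) : f₁ = f₂ :=
  funext fun t => by rw [h₁.2 t, h₂.2 t, h (projI_mem t)]

theorem intervalIntegrable_of_measurable_of_bounded {φ : ℝ → ℝ} (hφ : Measurable φ) {C : ℝ}
    (hC : ∀ x, |φ x| ≤ C) (s t : ℝ) : IntervalIntegrable φ volume s t :=
  (intervalIntegrable_const (c := C)).mono_fun hφ.aestronglyMeasurable
    (.of_forall fun x => (hC x).trans (le_abs_self C))

/-- The Picard operator for the drift `s ↦ b (x + g s)`, conjugated by the weight
`t ↦ exp (c * t)`, which makes it a contraction on `[0,1]` for `c` large. -/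
noncomputable def weightedPicard (b g : ℝ → ℝ) (c : ℝ) (u : C(Icc (0 : ℝ) 1, ℝ)) (t : ℝ) : ℝ :=
  Real.exp (-(c * t)) *
    ∫ s in (0 : ℝ)..t, b (Real.exp (c * s) * u (projIcc 0 1 zero_le_one s) + g s)

section weightedPicard

variable {b g : ℝ → ℝ} {C c : ℝ} {K : ℝ≥0}

theorem intervalIntegrable_drift (hC : ∀ x, |b x| ≤ C) (hb : Continuous b) (hg : Measurable g)
    (u : C(Icc (0 : ℝ) 1, ℝ)) (s t : ℝ) :
    IntervalIntegrable (fun s => b (Real.exp (c * s) * u (projIcc 0 1 zero_le_one s) + g s))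
      volume s t := by
  refine intervalIntegrable_of_measurable_of_bounded (hb.measurable.comp (Measurable.add ?_ hg))
    (fun x => hC _) s t
  have hu : Continuous fun s => u (projIcc 0 1 zero_le_one s) := u.continuous.comp continuous_projIcc
  exact Continuous.measurable (by fun_prop)

theorem continuous_weightedPicard (hC : ∀ x, |b x| ≤ C) (hb : Continuous b) (hg : Measurable g)
    (u : C(Icc (0 : ℝ) 1, ℝ)) : Continuous (weightedPicard b g c u) :=
  Continuous.mul (by fun_prop)
    (intervalIntegral.continuous_primitive (intervalIntegrable_drift hC hb hg u) 0)

theorem abs_weightedPicard_sub_le (hC : ∀ x, |b x| ≤ C) (hb : LipschitzWith K b)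
    (hg : Measurable g) (hc : 0 < c) (u v : C(Icc (0 : ℝ) 1, ℝ)) {t : ℝ} (ht : 0 ≤ t) :
    |weightedPicard b g c u t - weightedPicard b g c v t| ≤ K / c * dist u v := by
  have hbound : |(∫ s in (0 : ℝ)..t, b (Real.exp (c * s) * u (projIcc 0 1 zero_le_one s) + g s)) -
      ∫ s in (0 : ℝ)..t, b (Real.exp (c * s) * v (projIcc 0 1 zero_le_one s) + g s)| ≤
      ∫ s in (0 : ℝ)..t, K * dist u v * Real.exp (c * s) := by
    rw [← intervalIntegral.integral_sub (intervalIntegrable_drift hC hb.continuous hg u 0 t)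
      (intervalIntegrable_drift hC hb.continuous hg v 0 t), ← Real.norm_eq_abs]
    refine intervalIntegral.norm_integral_le_of_norm_le ht (.of_forall fun s _ => ?_)
      (Continuous.intervalIntegrable (by fun_prop) _ _)
    rw [← dist_eq_norm]
    refine (hb.dist_le_mul _ _).trans ?_
    rw [dist_add_right, Real.dist_eq, ← mul_sub, abs_mul, Real.abs_exp, ← Real.dist_eq]
    calc (K : ℝ) * (Real.exp (c * s) * dist (u (projIcc 0 1 zero_le_one s))
          (v (projIcc 0 1 zero_le_one s)))
        ≤ K * (Real.exp (c * s) * dist u v) := by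
          gcongr
          exact ContinuousMap.dist_apply_le_dist _
      _ = K * dist u v * Real.exp (c * s) := by ring
  have hint : ∫ s in (0 : ℝ)..t, (K : ℝ) * dist u v * Real.exp (c * s) =
      K * dist u v * (c⁻¹ * (Real.exp (c * t) - 1)) := by
    rw [intervalIntegral.integral_const_mul, intervalIntegral.integral_comp_mul_left _ hc.ne']
    simp
  rw [weightedPicard, weightedPicard, ← mul_sub, abs_mul, Real.abs_exp]
  calc _ ≤ Real.exp (-(c * t)) * (K * dist u v * (c⁻¹ * Real.exp (c * t))) := by
        refine mul_le_mul_of_nonneg_left (hbound.trans (hint.trans_le ?_)) (Real.exp_pos _).le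
        gcongr
        linarith
    _ = (Real.exp (-(c * t)) * Real.exp (c * t)) * (K / c * dist u v) := by ring
    _ = K / c * dist u v := by rw [← Real.exp_add]; simp

/-- The conjugated Picard operator has exactly one fixed point in `C([0,1])`. -/
theorem existsUnique_weightedPicard_fixedPoint (hC : ∀ x, |b x| ≤ C) (hb : LipschitzWith K b)
    (hg : Measurable g) (hc : K < c) :
    ∃! u : C(Icc (0 : ℝ) 1, ℝ), ∀ t : Icc (0 : ℝ) 1, weightedPicard b g c u t = u t := by
  have hc0 : 0 < c := K.coe_nonneg.trans_lt hc
  let T : C(Icc (0 : ℝ) 1, ℝ) → C(Icc (0 : ℝ) 1, ℝ) := fun u =>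
    ⟨fun t => weightedPicard b g c u t,
      (continuous_weightedPicard hC hb.continuous hg u).comp continuous_subtype_val⟩
  have hT : ContractingWith (K / c.toNNReal) T := by
    refine ⟨(div_lt_one (Real.toNNReal_pos.2 hc0)).2 (Real.lt_toNNReal_iff_coe_lt.2 hc),
      LipschitzWith.of_dist_le_mul fun u v => ?_⟩
    rw [NNReal.coe_div, Real.coe_toNNReal _ hc0.le]
    refine (ContinuousMap.dist_le (by positivity)).2 fun t => ?_
    exact abs_weightedPicard_sub_le hC hb hg hc0 u v t.2.1
  refine ⟨ContractingWith.fixedPoint T hT,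
    fun t => DFunLike.congr_fun hT.fixedPoint_isFixedPt t, fun u hu => ?_⟩
  exact hT.fixedPoint_unique (ContinuousMap.ext hu)

end weightedPicard

/-- For bounded Lipschitz `b` and every càdlàg `g` there is a unique càdlàg
`f` with `f t = ∫₀ᵗ b (f s) ds + g t` on `[0,1]`. -/
theorem solution_exists_unique
    (b : ℝ → ℝ) (hbdd : ∃ C : ℝ, ∀ x : ℝ, |b x| ≤ C)
    (hlip : ∃ K : NNReal, LipschitzWith K b)
    (g : ℝ → ℝ) (hg : MemD g) :
    ∃! f : ℝ → ℝ, MemD f ∧ SolvesODE b g f := by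
  obtain ⟨C, hC⟩ := hbdd
  obtain ⟨K, hK⟩ := hlip
  obtain ⟨u, hu, huniq⟩ := existsUnique_weightedPicard_fixedPoint hC hK hg.measurable
    (lt_add_one (K : ℝ))
  set c : ℝ := K + 1
  have hcancel : ∀ t x : ℝ, Real.exp (c * t) * (Real.exp (-(c * t)) * x) = x := fun t x => by
    rw [← mul_assoc, ← Real.exp_add]; simp
  have hsolves : ∀ f, MemD f → SolvesODE b g f →
      EqOn f (fun t => Real.exp (c * t) * u (projIcc 0 1 zero_le_one t) + g t) (Icc 0 1) := by
    intro f hf hfs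
    let v : C(Icc (0 : ℝ) 1, ℝ) := ⟨fun t => Real.exp (-(c * t)) * ∫ s in (0 : ℝ)..t, b (f s), by
      have hint : Continuous fun t => ∫ s in (0 : ℝ)..t, b (f s) :=
        intervalIntegral.continuous_primitive (intervalIntegrable_of_measurable_of_bounded
          (hK.continuous.measurable.comp hf.measurable) fun x => hC _) 0
      fun_prop⟩
    have hfv : EqOn f (fun t => Real.exp (c * t) * v (projIcc 0 1 zero_le_one t) + g t)
        (Icc 0 1) := fun t ht => by
      simp only [projIcc_of_mem zero_le_one ht, v, ContinuousMap.coe_mk, hcancel]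
      exact hfs t ht
    have hv : v = u := huniq v fun t => by
      change _ = Real.exp (-(c * t)) * ∫ s in (0 : ℝ)..t, b (f s)
      rw [weightedPicard]
      congr 1
      refine intervalIntegral.integral_congr fun s hs => ?_
      rw [uIcc_of_le t.2.1] at hs
      exact congrArg b (hfv ⟨hs.1, hs.2.trans t.2.2⟩).symm
    rwa [hv] at hfv
  have hw : Continuous fun t => Real.exp (c * t) * u (projIcc 0 1 zero_le_one t) :=
    Continuous.mul (by fun_prop) (u.continuous.comp continuous_projIcc)
  have hmem := hg.add_continuous hw
  refine ⟨_, ⟨hmem, fun t ht => ?_⟩, fun f hf => hf.1.eq_of_eqOn hmem fun t ht => ?_⟩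
  · have h := hu ⟨t, ht⟩
    simp only [projI_of_mem ht, projIcc_of_mem zero_le_one ht, ← h, weightedPicard, hcancel]
    congr 1
    refine intervalIntegral.integral_congr fun s hs => ?_
    rw [uIcc_of_le ht.1] at hs
    simp only [projI_of_mem (⟨hs.1, hs.2.trans ht.2⟩ : s ∈ Icc (0 : ℝ) 1)]
  · simpa only [projI_of_mem ht] using hsolves f hf.1 hf.2 ht
end

section
/- Fix reals α, β > 1. For every y ∈ ℝ₊², inf{ Ĩ(ξ) : ξ ∈ D, π(ξ) = y } = inf{ I(ξ) : ξ ∈ D, π(ξ) = y } (with the convention that the infimum over the empty set is ∞). -/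
open Set Filter Topology MeasureTheory
open scoped ENNReal NNReal

/-- Elements of `D` are right-continuous on the whole real line. -/
theorem MemD.tendsto_nhdsGE {f : ℝ → ℝ} (hf : MemD f) (t : ℝ) :
    Tendsto f (𝓝[≥] t) (𝓝 (f t)) := by
  rcases lt_or_ge t 0 with h0 | h0
  · refine tendsto_const_nhds.congr' ?_
    filter_upwards [mem_nhdsWithin_of_mem_nhds (Iio_mem_nhds h0)] with s hs
    have hproj {r : ℝ} (hr : r < 0) : projI r = 0 :=
      max_eq_left ((min_le_right _ _).trans hr.le)
    rw [hf.2 t, hf.2 s, hproj h0, hproj hs]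
  · rcases lt_or_ge t 1 with h1 | h1
    · exact hf.1.1 t ⟨h0, h1⟩
    · refine tendsto_const_nhds.congr' ?_
      filter_upwards [self_mem_nhdsWithin] with s hs
      have hproj {r : ℝ} (hr : 1 ≤ r) : projI r = 1 := by simp [projI, hr]
      rw [hf.2 t, hf.2 s, hproj h1, hproj (h1.trans hs)]

/-- A right-continuous real function is Borel measurable. -/
theorem measurable_of_tendsto_nhdsGE {f : ℝ → ℝ}
    (hf : ∀ t, Tendsto f (𝓝[≥] t) (𝓝 (f t))) : Measurable f := by
  refine measurable_of_tendsto_metrizable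
    (f := fun (n : ℕ) (t : ℝ) => f (((⌊t * (n + 1)⌋ : ℝ) + 1) / (n + 1))) (fun n => ?_) ?_
  · have hg : Measurable fun k : ℤ => f (((k : ℝ) + 1) / (n + 1)) := Measurable.of_discrete
    exact hg.comp (Int.measurable_floor.comp (measurable_id.mul_const ((n : ℝ) + 1)))
  · rw [tendsto_pi_nhds]
    intro t
    refine (hf t).comp (tendsto_nhdsWithin_iff.2 ⟨?_, Eventually.of_forall fun n => ?_⟩)
    · have hlim : Tendsto (fun n : ℕ => t + 1 / ((n : ℝ) + 1)) atTop (𝓝 t) := by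
        simpa using (tendsto_one_div_add_atTop_nhds_zero_nat (𝕜 := ℝ)).const_add t
      refine tendsto_of_tendsto_of_tendsto_of_le_of_le tendsto_const_nhds hlim
        (fun n => ?_) (fun n => ?_)
      · have hn : (0 : ℝ) < n + 1 := by positivity
        exact (le_div_iff₀ hn).2 (Int.lt_floor_add_one _).le
      · have hn : (0 : ℝ) < n + 1 := by positivity
        change _ / _ ≤ _
        rw [div_le_iff₀ hn, add_mul, one_div_mul_cancel hn.ne']
        gcongr
        exact Int.floor_le _
    · have hn : (0 : ℝ) < n + 1 := by positivity
      exact (le_div_iff₀ hn).2 (Int.lt_floor_add_one _).le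

/-- A path and the solution of the ODE that it drives have the same jumps. -/
theorem SolvesODE.sub_leftLim_eq {b g f : ℝ → ℝ} (hODE : SolvesODE b g f)
    (hg : MemD g) (hint : ∀ x y, IntervalIntegrable (fun s => b (f s)) volume x y)
    {t : ℝ} (ht : t ∈ Ioc (0 : ℝ) 1) :
    f t - Function.leftLim f t = g t - Function.leftLim g t := by
  obtain ⟨L, hL⟩ := hg.1.2 t ht
  have hprim : Tendsto (fun r => ∫ s in (0 : ℝ)..r, b (f s)) (𝓝[<] t)
      (𝓝 (∫ s in (0 : ℝ)..t, b (f s))) :=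
    ((intervalIntegral.continuous_primitive hint 0).tendsto t).mono_left nhdsWithin_le_nhds
  have hf : Tendsto f (𝓝[<] t) (𝓝 ((∫ s in (0 : ℝ)..t, b (f s)) + L)) := by
    refine (hprim.add hL).congr' ?_
    filter_upwards [Ioo_mem_nhdsLT ht.1] with r hr
    exact (hODE r ⟨hr.1.le, hr.2.le.trans ht.2⟩).symm
  rw [leftLim_eq_of_tendsto hf, leftLim_eq_of_tendsto hL,
    hODE t ⟨ht.1.le, ht.2⟩]
  ring

/-- The solution map of an ODE with bounded continuous drift preserves the largest jumps. -/
theorem SolvesODE.piMap_eq {b : ℝ → ℝ} (hbdd : ∃ C : ℝ, ∀ x : ℝ, |b x| ≤ C)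
    (hb : Continuous b) {g f : ℝ → ℝ} (hODE : SolvesODE b g f) (hg : MemD g) (hf : MemD f) :
    piMap f = piMap g := by
  obtain ⟨C, hC⟩ := hbdd
  have hmeas : Measurable fun s => b (f s) :=
    hb.measurable.comp (measurable_of_tendsto_nhdsGE hf.tendsto_nhdsGE)
  have hint (x y : ℝ) : IntervalIntegrable (fun s => b (f s)) volume x y :=
    (intervalIntegrable_const (c := C)).mono_fun' hmeas.aestronglyMeasurable
      (Eventually.of_forall fun s => hC (f s))
  have hjump (t : Ioc (0 : ℝ) 1) := hODE.sub_leftLim_eq hg hint t.2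
  refine Prod.ext (iSup_congr hjump) (iSup_congr fun t => ?_)
  linarith [hjump t]

/-- For every `y ∈ ℝ₊²`,
`inf { Ĩ ξ : π ξ = y } = inf { I ξ : π ξ = y }`. -/
theorem iInf_Itilde_pi_eq_iInf_Ifun_pi
    (α β : ℝ) (hα : 1 < α) (hβ : 1 < β)
    (b : ℝ → ℝ) (hbdd : ∃ C : ℝ, ∀ x : ℝ, |b x| ≤ C)
    (hlip : ∃ K : NNReal, LipschitzWith K b)
    (F : DD → DD) (hF : ∀ g : DD, SolvesODE b g.1 (F g).1) :
    ∀ y : ℝ × ℝ, 0 ≤ y.1 → 0 ≤ y.2 →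
      (⨅ (ξ : DD) (_ : piMap ξ.1 = y), Itilde α β F ξ)
        = ⨅ (ξ : DD) (_ : piMap ξ.1 = y), Ifun α β ξ := by
  intro y _ _
  obtain ⟨K, hK⟩ := hlip
  have hπ (η : DD) : piMap (F η).1 = piMap η.1 :=
    (hF η).piMap_eq hbdd hK.continuous η.2 (F η).2
  apply le_antisymm
  · refine le_iInf₂ fun η hη => le_iInf₂ fun p hp => ?_
    exact (iInf₂_le (F η) ((hπ η).trans hη)).trans (iInf₂_le p ⟨η, hp, rfl⟩)
  · refine le_iInf₂ fun ξ hξ => le_iInf₂ fun p hp => ?_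
    obtain ⟨η, hp, rfl⟩ := hp
    exact (iInf₂_le η ((hπ η).symm.trans hξ)).trans (iInf₂_le p hp)
end
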